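/- Let (M, I(M)) be a pi-space. A subset F ⊆ M is a flat of finite rank if and only if F = Cl(σ) for some finite independent set σ ∈ I(M). -/

import Mathlib

open Set

/-- A pre-independence space (pi-space): a non-empty ground set `M` together with a
non-empty collection `Ind` of subsets of `M` (the independent sets) that is closed
under taking subsets (I1) and satisfies the finite exchange property (I2). -/
structure PiSpace (α : Type*) where
  M : Set α
  Ind : Set (Set α)
  M_nonempty : M.Nonempty
  Ind_nonempty : Ind.Nonempty
  ind_subset_M : ∀ σ ∈ Ind, σ ⊆ M
  downward_closed : ∀ σ ∈ Ind, ∀ τ ⊆ σ, τ ∈ Ind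
  exchange : ∀ σ ∈ Ind, ∀ τ ∈ Ind, σ.Finite → τ.Finite → τ.ncard < σ.ncard →
    ∃ x ∈ σ \ τ, insert x τ ∈ Ind

namespace PiSpace

variable {α : Type*}

/-- Condition (FC): a pi-space is a finitary matroid if every set all of whose finite
subsets are independent is itself independent. -/
def Finitary (P : PiSpace α) : Prop :=
  ∀ σ ⊆ P.M, (∀ τ ⊆ σ, τ.Finite → τ ∈ P.Ind) → σ ∈ P.Ind

/-- The set of finite independent sets `I(M)_fin`. -/
def IndFin (P : PiSpace α) : Set (Set α) := {σ ∈ P.Ind | σ.Finite}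

/-- The family `I(M)_W` of sets all of whose finite subsets are independent. -/
def IndW (P : PiSpace α) : Set (Set α) :=
  {σ | σ ⊆ P.M ∧ ∀ τ ⊆ σ, τ.Finite → τ ∈ P.Ind}

/-- The independent sets contained in `N`, i.e. `I(M,N)`. -/
def restrictInd (P : PiSpace α) (N : Set α) : Set (Set α) := {σ ∈ P.Ind | σ ⊆ N}

/-- `I(M.X)`: independent sets of the contraction of `M` by `M \ X`. -/
def contractInd (P : PiSpace α) (X : Set α) : Set (Set α) :=
  {σ ∈ P.restrictInd X | ∃ τ ∈ P.restrictInd (P.M \ X),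
    (∀ ρ ∈ P.restrictInd (P.M \ X), τ ⊆ ρ → ρ = τ) ∧ σ ∪ τ ∈ P.Ind}

/-- The rank of a subset `X`: the supremum of the cardinalities (in `ℕ∞`) of the
independent sets contained in `X`. -/
noncomputable def rk (P : PiSpace α) (X : Set α) : ℕ∞ :=
  ⨆ σ ∈ {σ : Set α | σ ∈ P.Ind ∧ σ ⊆ X}, σ.encard

/-- A flat of a pi-space. -/
def IsFlat (P : PiSpace α) (F : Set α) : Prop :=
  F ⊆ P.M ∧ ∀ x ∈ P.M \ F, ∀ σ ∈ P.Ind, σ ⊆ F → insert x σ ∈ P.Ind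

/-- The set of loops `0_{I(M)}`. -/
def loops (P : PiSpace α) : Set α := {x ∈ P.M | {x} ∉ P.Ind}

/-- A dependent subset of `M`. -/
def Dep (P : PiSpace α) (X : Set α) : Prop := X ⊆ P.M ∧ X ∉ P.Ind

/-- A circuit: a minimal dependent set. -/
def IsCircuit (P : PiSpace α) (C : Set α) : Prop :=
  P.Dep C ∧ ∀ C' ⊂ C, C' ∈ P.Ind

/-- The closure of a subset `X`. -/
def cl (P : PiSpace α) (X : Set α) : Set α :=
  X ∪ {x ∈ P.M | ∃ C, P.IsCircuit C ∧ x ∈ C ∧ C ⊆ X ∪ {x}}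

/-- The join of two flats: the intersection of all flats containing both. -/
def flatJoin (P : PiSpace α) (F G : Set α) : Set α :=
  ⋂₀ {H | P.IsFlat H ∧ F ⊆ H ∧ G ⊆ H}

/-- `Φ(σ)`: the intersection of all flats containing `σ`. -/
def Phi (P : PiSpace α) (σ : Set α) : Set α := ⋂₀ {F | P.IsFlat F ∧ σ ⊆ F}

/-- A finitely closed set: it contains the closure of each of its finite
independent subsets. -/
def FinitelyClosed (P : PiSpace α) (X : Set α) : Prop :=
  ∀ σ ∈ P.Ind, σ ⊆ X → σ.Finite → P.cl σ ⊆ X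

/-- An atom of the poset of flats: a flat strictly containing the loops and
minimal with this property. -/
def IsFlatAtom (P : PiSpace α) (A : Set α) : Prop :=
  P.IsFlat A ∧ P.loops ⊂ A ∧ ∀ F, P.IsFlat F → P.loops ⊂ F → F ⊆ A → F = A

end PiSpace

/-- Flats of an arbitrary pair (ground set, family of independent sets). -/
def IsFlatIn {α : Type*} (Mset : Set α) (Ind : Set (Set α)) (F : Set α) : Prop :=
  F ⊆ Mset ∧ ∀ x ∈ Mset \ F, ∀ σ ∈ Ind, σ ⊆ F → insert x σ ∈ Ind

/-- The rank of `X` with respect to a family `Ind` of independent sets. -/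
noncomputable def rkIn {α : Type*} (Ind : Set (Set α)) (X : Set α) : ℕ∞ :=
  ⨆ σ ∈ {σ : Set α | σ ∈ Ind ∧ σ ⊆ X}, σ.encard

namespace PiSpace

theorem empty_mem_ind {α : Type*} (P : PiSpace α) : ∅ ∈ P.Ind :=
  let ⟨ρ, hρ⟩ := P.Ind_nonempty
  P.downward_closed ρ hρ ∅ (empty_subset ρ)

/-- Every finite dependent set contains a circuit. -/
theorem Dep.exists_isCircuit_subset {α : Type*} {P : PiSpace α} {X : Set α}
    (hX : P.Dep X) (hfin : X.Finite) : ∃ C ⊆ X, P.IsCircuit C := by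
  obtain ⟨C, hCX, hC⟩ := (hfin.finite_subsets.subset
    (fun Y (hY : Y ⊆ X ∧ P.Dep Y) => hY.1)).exists_le_minimal ⟨Subset.rfl, hX⟩
  refine ⟨C, hCX, hC.prop.2, fun D hD => ?_⟩
  by_contra h
  exact hD.2 (hC.le_of_le ⟨hD.1.trans hCX, hD.1.trans hC.prop.2.1, h⟩ hD.1)

theorem mem_cl_iff {α : Type*} {P : PiSpace α} {σ : Set α} (hσ : σ ∈ P.Ind)
    (hfin : σ.Finite) {x : α} : x ∈ P.cl σ ↔ x ∈ σ ∨ x ∈ P.M ∧ insert x σ ∉ P.Ind := by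
  refine or_congr_right (and_congr_right fun hxM => ⟨?_, fun h => ?_⟩)
  · rintro ⟨C, hC, -, hCσ⟩ h
    exact hC.1.2 (P.downward_closed _ h C (union_singleton ▸ hCσ))
  · have hdep : P.Dep (insert x σ) := ⟨insert_subset hxM (P.ind_subset_M σ hσ), h⟩
    obtain ⟨C, hCσ, hC⟩ := hdep.exists_isCircuit_subset (hfin.insert x)
    refine ⟨C, hC, ?_, union_singleton ▸ hCσ⟩
    by_contra hxC
    exact hC.1.2 (P.downward_closed σ hσ C ((subset_insert_iff_of_notMem hxC).1 hCσ))

theorem cl_subset_M {α : Type*} {P : PiSpace α} {σ : Set α} (hσ : σ ∈ P.Ind) :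
    P.cl σ ⊆ P.M :=
  union_subset (P.ind_subset_M σ hσ) fun _ hx => hx.1

/-- Independent subsets of the closure of a finite independent set `σ` have at most as many
elements as `σ`. -/
theorem encard_le_of_subset_cl {α : Type*} {P : PiSpace α} {σ τ : Set α} (hσ : σ ∈ P.Ind)
    (hfin : σ.Finite) (hτ : τ ∈ P.Ind) (hτσ : τ ⊆ P.cl σ) : τ.encard ≤ σ.encard := by
  by_contra! hlt
  obtain ⟨ρ, hρτ, hρ⟩ := exists_subset_encard_eq (Order.add_one_le_of_lt hlt)
  have hρfin : ρ.Finite := by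
    rw [← encard_lt_top_iff, hρ]
    exact WithTop.add_lt_top.2 ⟨hfin.encard_lt_top, ENat.natCast_lt_top 1⟩
  have hcard : σ.ncard < ρ.ncard := by
    rw [← hρfin.cast_ncard_eq, ← hfin.cast_ncard_eq] at hρ
    norm_cast at hρ
    omega
  obtain ⟨x, hx, hxσ⟩ :=
    P.exchange ρ (P.downward_closed τ hτ ρ hρτ) σ hσ hρfin hfin hcard
  rcases (mem_cl_iff hσ hfin).1 (hτσ (hρτ hx.1)) with h | h
  exacts [hx.2 h, h.2 hxσ]

theorem isFlat_cl {α : Type*} {P : PiSpace α} {σ : Set α} (hσ : σ ∈ P.Ind)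
    (hfin : σ.Finite) : P.IsFlat (P.cl σ) := by
  refine ⟨cl_subset_M hσ, fun x ⟨hxM, hx⟩ τ hτ hτσ => ?_⟩
  rw [mem_cl_iff hσ hfin] at hx
  push Not at hx
  have hxσ : insert x σ ∈ P.Ind := hx.2 hxM
  induction h : σ.ncard + 1 - τ.ncard using Nat.strong_induction_on generalizing τ with
  | _ n ih =>
    subst h
    have hle := encard_le_of_subset_cl hσ hfin hτ hτσ
    have hτfin : τ.Finite := hfin.finite_of_encard_le hle
    have hcard : τ.ncard ≤ σ.ncard := ENat.toNat_le_toNat hle hfin.encard_lt_top.ne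
    obtain ⟨y, ⟨hy, hyτ⟩, hyi⟩ := P.exchange _ hxσ τ hτ (hfin.insert x) hτfin
      (by rw [ncard_insert_of_notMem hx.1 hfin]; omega)
    rcases hy with rfl | hy
    · exact hyi
    · refine P.downward_closed _ (ih _ ?_ (insert y τ) hyi
        (insert_subset (Or.inl hy) hτσ) rfl) _ (insert_subset_insert (subset_insert y τ))
      rw [ncard_insert_of_notMem hyτ hτfin]
      omega

theorem encard_le_rk {α : Type*} {P : PiSpace α} {σ X : Set α} (hσ : σ ∈ P.Ind)
    (hσX : σ ⊆ X) : σ.encard ≤ P.rk X :=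
  le_iSup₂_of_le (f := fun τ (_ : τ ∈ {τ : Set α | τ ∈ P.Ind ∧ τ ⊆ X}) => τ.encard)
    σ ⟨hσ, hσX⟩ le_rfl

/-- A set of finite rank contains an independent set that is maximal among the independent
subsets. -/
theorem exists_maximal_ind_of_rk_lt_top {α : Type*} {P : PiSpace α} {X : Set α}
    (hX : P.rk X < ⊤) :
    ∃ σ ∈ P.Ind, σ.Finite ∧ σ ⊆ X ∧ ∀ x ∈ X \ σ, insert x σ ∉ P.Ind := by
  have hfin : ∀ τ ∈ P.Ind, τ ⊆ X → τ.Finite := fun τ hτ hτX =>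
    encard_lt_top_iff.1 ((encard_le_rk hτ hτX).trans_lt hX)
  let S : Set ℕ := image ncard {τ | τ ∈ P.Ind ∧ τ ⊆ X}
  have hbdd : BddAbove S := by
    refine ⟨(P.rk X).toNat, ?_⟩
    rintro _ ⟨τ, ⟨hτ, hτX⟩, rfl⟩
    exact ENat.toNat_le_toNat (encard_le_rk hτ hτX) hX.ne
  have hne : S.Nonempty := ⟨_, ∅, ⟨P.empty_mem_ind, empty_subset X⟩, rfl⟩
  obtain ⟨σ, ⟨hσ, hσX⟩, hσS⟩ := Nat.sSup_mem hne hbdd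
  refine ⟨σ, hσ, hfin σ hσ hσX, hσX, fun x hx h => ?_⟩
  have hle := le_csSup hbdd ⟨_, ⟨h, insert_subset hx.1 hσX⟩, rfl⟩
  rw [← hσS, ncard_insert_of_notMem hx.2 (hfin σ hσ hσX)] at hle
  omega

end PiSpace

/-- A subset `F ⊆ M` is a flat of finite rank if and only if
`F = Cl(σ)` for some finite independent set `σ`. -/
theorem finite_rank_flats_are_closures {α : Type*} (P : PiSpace α) (F : Set α) :
    (P.IsFlat F ∧ P.rk F < ⊤) ↔ ∃ σ ∈ P.Ind, σ.Finite ∧ F = P.cl σ := by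
  constructor
  · rintro ⟨hF, hrk⟩
    obtain ⟨σ, hσ, hfin, hσF, hmax⟩ := PiSpace.exists_maximal_ind_of_rk_lt_top hrk
    refine ⟨σ, hσ, hfin, ext fun x => ?_⟩
    rw [PiSpace.mem_cl_iff hσ hfin]
    refine ⟨fun hx => or_iff_not_imp_left.2 fun hxσ => ⟨hF.1 hx, hmax x ⟨hx, hxσ⟩⟩, ?_⟩
    rintro (hx | ⟨hxM, hx⟩)
    · exact hσF hx
    · by_contra hxF
      exact hx (hF.2 x ⟨hxM, hxF⟩ σ hσ hσF)
  · rintro ⟨σ, hσ, hfin, rfl⟩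
    exact ⟨PiSpace.isFlat_cl hσ hfin, (iSup₂_le fun τ hτ =>
      PiSpace.encard_le_of_subset_cl hσ hfin hτ.1 hτ.2).trans_lt hfin.encard_lt_top⟩
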